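/- arXiv:1708.08084 — 2 statements merged into one kernel-verified Lean document; each statement's English description precedes it below -/
import Mathlib

section
/- There exist constants c > 0 and C ≥ 1 depending only on n such that for every (ω₁, ω₂) ∈ A_{(2,2)} on ℝ^n and every r with 0 < r ≤ c·[ω₁,ω₂]^{−2}_{A_{(2,2)}}, the pair (ω₁^{1+r}, ω₂^{1+r}) belongs to A_{(2,2)} and [ω₁^{1+r}, ω₂^{1+r}]_{A_{(2,2)}} ≤ C·[ω₁,ω₂]^{1+r}_{A_{(2,2)}} (a reverse Hölder inequality for multiple weights). -/
open MeasureTheory ENNReal Filter Set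
open scoped ENNReal NNReal

noncomputable section

/-- Euclidean space ℝⁿ. -/
abbrev Euc (n : ℕ) := EuclideanSpace ℝ (Fin n)

/-- The axis-parallel cube with center `c` and half side-length `h`. -/
def cube {n : ℕ} (c : Euc n) (h : ℝ) : Set (Euc n) := {x | ∀ i, |x i - c i| ≤ h}

/-- A weight: a locally integrable, a.e. positive function. -/
def IsWeight {n : ℕ} (w : Euc n → ℝ) : Prop :=
  LocallyIntegrable w volume ∧ ∀ᵐ x : Euc n ∂volume, 0 < w x

/-- Average of (the nonnegative part of) `w` over the cube `cube c h`, valued in `ℝ≥0∞`. -/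
def eAvg {n : ℕ} (w : Euc n → ℝ) (c : Euc n) (h : ℝ) : ℝ≥0∞ :=
  (∫⁻ x in cube c h, ENNReal.ofReal (w x)) / volume (cube c h)

/-- Conjugate exponent `p' = p/(p-1)`. -/
def conjExp (p : ℝ) : ℝ := p / (p - 1)

/-- The `A_p` ratio over a fixed cube. -/
def apRatio {n : ℕ} (p : ℝ) (w : Euc n → ℝ) (c : Euc n) (h : ℝ) : ℝ≥0∞ :=
  eAvg w c h * (eAvg (fun x => w x ^ (1 - conjExp p)) c h) ^ (p - 1)

/-- The Muckenhoupt `A_p` constant. -/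
def apConst (n : ℕ) (p : ℝ) (w : Euc n → ℝ) : ℝ≥0∞ :=
  ⨆ (c : Euc n) (h : ℝ) (_ : 0 < h), apRatio p w c h

/-- Hardy–Littlewood maximal function (over cubes), `ℝ≥0∞`-valued. -/
def hlMax {n : ℕ} (f : Euc n → ℝ) (x : Euc n) : ℝ≥0∞ :=
  ⨆ (c : Euc n) (h : ℝ) (_ : 0 < h) (_ : x ∈ cube c h),
    (∫⁻ y in cube c h, ENNReal.ofReal |f y|) / volume (cube c h)

/-- The Fujii–Wilson `B_∞` ratio over a fixed cube. -/
def bRatio {n : ℕ} (w : Euc n → ℝ) (c : Euc n) (h : ℝ) : ℝ≥0∞ :=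
  (∫⁻ x in cube c h, hlMax ((cube c h).indicator w) x) /
    (∫⁻ x in cube c h, ENNReal.ofReal (w x))

/-- The Fujii–Wilson `B_∞` constant. -/
def bConst (n : ℕ) (w : Euc n → ℝ) : ℝ≥0∞ :=
  ⨆ (c : Euc n) (h : ℝ) (_ : 0 < h), bRatio w c h

/-- The bilinear `A_{(2,2)}` ratio over a fixed cube. -/
def a22Ratio {n : ℕ} (w1 w2 : Euc n → ℝ) (c : Euc n) (h : ℝ) : ℝ≥0∞ :=
  eAvg (fun x => w1 x ^ ((1:ℝ)/2) * w2 x ^ ((1:ℝ)/2)) c h *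
    ((eAvg (fun x => (w1 x)⁻¹) c h) ^ ((1:ℝ)/2) * (eAvg (fun x => (w2 x)⁻¹) c h) ^ ((1:ℝ)/2))

/-- The bilinear `A_{(2,2)}` constant. -/
def a22Const (n : ℕ) (w1 w2 : Euc n → ℝ) : ℝ≥0∞ :=
  ⨆ (c : Euc n) (h : ℝ) (_ : 0 < h), a22Ratio w1 w2 c h

/-- Weighted `L²` norm, `ℝ≥0∞`-valued. -/
def wL2 {n : ℕ} (w f : Euc n → ℝ) : ℝ≥0∞ :=
  (∫⁻ x, ENNReal.ofReal (f x ^ 2 * w x)) ^ ((1:ℝ)/2)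

/-- Weighted `L¹` norm, `ℝ≥0∞`-valued. -/
def wL1 {n : ℕ} (w f : Euc n → ℝ) : ℝ≥0∞ :=
  ∫⁻ x, ENNReal.ofReal (|f x| * w x)

/-- The cell of generation `m` containing `x`, for the partitions encoded by `idx`. -/
def gridCell {X ι : Type*} (idx : ℕ → X → ι) (m : ℕ) (x : X) : Set X := {y | idx m y = idx m x}

/-- The generation-`m` cell of `x` has `μ`-average over `ρ` exceeding `l`. -/
def HighAt {X ι : Type*} [MeasurableSpace X] (ρ μ : Measure X) (idx : ℕ → X → ι) (l : ℝ≥0∞)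
    (m : ℕ) (x : X) : Prop :=
  l * ρ (gridCell idx m x) < μ (gridCell idx m x)

/-- The super-level set of the maximal function attached to the partitions `idx`. -/
def highSet {X ι : Type*} [MeasurableSpace X] (ρ μ : Measure X) (idx : ℕ → X → ι) (l : ℝ≥0∞) :
    Set X :=
  {x | ∃ m, HighAt ρ μ idx l m x}

section Grid

variable {X ι : Type*} {idx : ℕ → X → ι}

theorem mem_gridCell_self (m : ℕ) (x : X) : x ∈ gridCell idx m x := rfl

theorem gridCell_congr {m : ℕ} {x y : X} (h : idx m y = idx m x) :
    gridCell idx m y = gridCell idx m x := by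
  simp [gridCell, h]

theorem idx_eq_of_le (hnest : ∀ m x y, idx (m + 1) y = idx (m + 1) x → idx m y = idx m x)
    {j m : ℕ} (hjm : j ≤ m) {x y : X} (h : idx m y = idx m x) : idx j y = idx j x := by
  induction hjm with
  | refl => exact h
  | step _ ih => exact ih (hnest _ _ _ h)

theorem gridCell_subset_of_le
    (hnest : ∀ m x y, idx (m + 1) y = idx (m + 1) x → idx m y = idx m x)
    {j m : ℕ} (hjm : j ≤ m) (x : X) : gridCell idx m x ⊆ gridCell idx j x :=
  fun _ hy => idx_eq_of_le hnest hjm hy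

variable [MeasurableSpace X] {ρ μ : Measure X}

theorem highAt_congr {l : ℝ≥0∞} {m : ℕ} {x y : X} (h : idx m y = idx m x) :
    HighAt ρ μ idx l m y ↔ HighAt ρ μ idx l m x := by
  rw [HighAt, HighAt, gridCell_congr h]

theorem highSet_anti {l l' : ℝ≥0∞} (h : l ≤ l') : highSet ρ μ idx l' ⊆ highSet ρ μ idx l := by
  rintro x ⟨m, hm⟩
  exact ⟨m, lt_of_le_of_lt (by gcongr) hm⟩

theorem measurableSet_gridCell [MeasurableSpace ι] [DiscreteMeasurableSpace ι]
    (hidx : ∀ m, Measurable (idx m)) (m : ℕ) (x : X) : MeasurableSet (gridCell idx m x) :=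
  hidx m (MeasurableSet.of_discrete (s := {idx m x}))

theorem measurableSet_highSet [MeasurableSpace ι] [DiscreteMeasurableSpace ι]
    (hidx : ∀ m, Measurable (idx m)) (l : ℝ≥0∞) : MeasurableSet (highSet ρ μ idx l) := by
  have : highSet ρ μ idx l =
      ⋃ m, idx m ⁻¹' {k | l * ρ (idx m ⁻¹' {k}) < μ (idx m ⁻¹' {k})} := by
    ext x
    simp only [highSet, HighAt, mem_iUnion, mem_ofPred_eq, mem_preimage]
    rfl
  rw [this]
  exact MeasurableSet.iUnion fun m => hidx m MeasurableSet.of_discrete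

/-- Comparison of two measures on a super-level set through its maximal cells. -/
theorem measure_highSet_le [MeasurableSpace ι] [DiscreteMeasurableSpace ι] [Countable ι]
    (hidx : ∀ m, Measurable (idx m))
    (hnest : ∀ m x y, idx (m + 1) y = idx (m + 1) x → idx m y = idx m x)
    (l : ℝ≥0∞) (R B : Set X) (α β : Measure X) (C : ℝ≥0∞)
    (hR : ∀ x ∈ R, ∀ m, HighAt ρ μ idx l m x → (∀ j < m, ¬ HighAt ρ μ idx l j x) →
      gridCell idx m x ⊆ R)
    (hC : ∀ x ∈ R, ∀ m, HighAt ρ μ idx l m x → (∀ j < m, ¬ HighAt ρ μ idx l j x) →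
      α (gridCell idx m x ∩ B) ≤ C * β (gridCell idx m x)) :
    α (R ∩ highSet ρ μ idx l ∩ B) ≤ C * β (R ∩ highSet ρ μ idx l) := by
  classical
  set S : ℕ × ι → Set X := fun p =>
    {x | x ∈ R ∧ HighAt ρ μ idx l p.1 x ∧ (∀ j < p.1, ¬ HighAt ρ μ idx l j x) ∧ idx p.1 x = p.2}
    with hS
  have hcell : ∀ p, ∀ x ∈ S p, S p = gridCell idx p.1 x := by
    rintro ⟨m, k⟩ x ⟨hxR, hx1, hx2, hx3⟩
    apply Subset.antisymm
    · rintro y ⟨_, _, _, hy⟩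
      exact hy.trans hx3.symm
    · intro y hy
      refine ⟨hR x hxR m hx1 hx2 hy, (highAt_congr hy).2 hx1, fun j hj => ?_, hy.trans hx3⟩
      rw [highAt_congr (idx_eq_of_le hnest hj.le hy)]
      exact hx2 j hj
  have hmeas : ∀ p, MeasurableSet (S p) := by
    intro p
    rcases (S p).eq_empty_or_nonempty with h | ⟨x, hx⟩
    · rw [h]; exact MeasurableSet.empty
    · rw [hcell p x hx]; exact measurableSet_gridCell hidx _ _
  have hdisj : Pairwise (Function.onFun Disjoint S) := by
    rintro ⟨m, k⟩ ⟨m', k'⟩ hne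
    refine Set.disjoint_left.2 ?_
    rintro x ⟨_, h1, h2, h3⟩ ⟨_, h1', h2', h3'⟩
    have hm : m = m' := by
      rcases lt_trichotomy m m' with h | h | h
      · exact absurd h1 (h2' _ h)
      · exact h
      · exact absurd h1' (h2 _ h)
    subst hm
    exact hne (by simp only [Prod.mk.injEq, true_and]; exact h3.symm.trans h3')
  have hunion : R ∩ highSet ρ μ idx l = ⋃ p, S p := by
    ext x
    simp only [mem_iUnion]
    constructor
    · rintro ⟨hxR, hx⟩
      exact ⟨(Nat.find hx, idx (Nat.find hx) x), hxR, Nat.find_spec hx,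
        fun j hj => Nat.find_min hx hj, rfl⟩
    · rintro ⟨p, hp⟩
      exact ⟨hp.1, p.1, hp.2.1⟩
  rw [hunion, iUnion_inter]
  calc α (⋃ p, S p ∩ B) ≤ ∑' p, α (S p ∩ B) := measure_iUnion_le _
    _ ≤ ∑' p, C * β (S p) := by
        refine ENNReal.tsum_le_tsum fun p => ?_
        rcases (S p).eq_empty_or_nonempty with h | ⟨x, hx⟩
        · simp [h]
        · rw [hcell p x hx]
          exact hC x hx.1 p.1 hx.2.1 hx.2.2.1
    _ = C * β (⋃ p, S p) := by
        rw [ENNReal.tsum_mul_left, measure_iUnion hdisj hmeas]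

/-- Weak-type bound for the maximal function, localized to a maximal cell of a lower level. -/
theorem mul_measure_gridCell_inter_highSet_le [MeasurableSpace ι] [DiscreteMeasurableSpace ι]
    [Countable ι] (hidx : ∀ m, Measurable (idx m))
    (hnest : ∀ m x y, idx (m + 1) y = idx (m + 1) x → idx m y = idx m x)
    {l l' : ℝ≥0∞} (hl : l ≤ l') {x : X} {m : ℕ} (hx : ∀ j < m, ¬ HighAt ρ μ idx l j x) :
    l' * ρ (gridCell idx m x ∩ highSet ρ μ idx l') ≤ μ (gridCell idx m x) := by
  have h := measure_highSet_le (ρ := ρ) (μ := μ) hidx hnest l' (gridCell idx m x) univ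
    (l' • ρ) μ 1 ?_ ?_
  · simp only [inter_univ, one_mul, Measure.smul_apply, smul_eq_mul] at h
    exact h.trans (measure_mono inter_subset_left)
  · intro y hy k hk _
    have hmk : m ≤ k := by
      by_contra! hkm
      refine hx k hkm ?_
      rw [← highAt_congr (idx_eq_of_le hnest hkm.le hy)]
      exact lt_of_le_of_lt (by gcongr) hk
    rw [← gridCell_congr hy]
    exact gridCell_subset_of_le hnest hmk y
  · intro y _ k hk _
    simpa using hk.le

/-- Geometric decay of `μ` along the super-level sets. -/
theorem measure_highSet_mul_le [MeasurableSpace ι] [DiscreteMeasurableSpace ι] [Countable ι]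
    (hidx : ∀ m, Measurable (idx m))
    (hnest : ∀ m x y, idx (m + 1) y = idx (m + 1) x → idx m y = idx m x)
    {D : ℝ≥0∞} (hD0 : D ≠ 0) (hD : D ≠ ∞)
    (hdoub : ∀ m x, ρ (gridCell idx m x) ≤ D * ρ (gridCell idx (m + 1) x))
    (hρ : ∀ m x, ρ (gridCell idx m x) ≠ ∞) (hμ : ∀ m x, μ (gridCell idx m x) ≠ ∞)
    {δ θ : ℝ≥0∞} (hδ : δ ≠ ∞) (hδθ : 1 ≤ θ + δ)
    (hA : ∀ m x, ∀ E ⊆ gridCell idx m x, MeasurableSet E →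
      ρ (gridCell idx m x) ≤ 2 * ρ E → δ * μ (gridCell idx m x) ≤ μ E)
    {x₀ : X} {l : ℝ≥0∞} (hl0 : l ≠ 0) (hl : l ≠ ∞)
    (hx₀ : μ (gridCell idx 0 x₀) ≤ l * ρ (gridCell idx 0 x₀)) (hD1 : 1 ≤ D) :
    μ (gridCell idx 0 x₀ ∩ highSet ρ μ idx (l * (2 * D))) ≤
      θ * μ (gridCell idx 0 x₀ ∩ highSet ρ μ idx l) := by
  have hle : l ≤ l * (2 * D) := by
    calc l = l * (1 * 1) := by simp
      _ ≤ l * (2 * D) := by gcongr; exact one_le_two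
  set Ω := highSet ρ μ idx (l * (2 * D)) with hΩ
  have hΩm : MeasurableSet Ω := measurableSet_highSet hidx _
  have key : μ (gridCell idx 0 x₀ ∩ highSet ρ μ idx l ∩ Ω) ≤
      θ * μ (gridCell idx 0 x₀ ∩ highSet ρ μ idx l) := by
    refine measure_highSet_le hidx hnest l (gridCell idx 0 x₀) Ω μ μ θ ?_ ?_
    · intro x hx m _ _
      rw [← gridCell_congr hx]
      exact gridCell_subset_of_le hnest (Nat.zero_le m) x
    · intro x hx m hm hmin
      set S := gridCell idx m x with hS
      have hSm : MeasurableSet S := measurableSet_gridCell hidx _ _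
      have hm0 : m ≠ 0 := by
        rintro rfl
        rw [highAt_congr hx] at hm
        exact absurd hm (not_lt.2 hx₀)
      obtain ⟨k, rfl⟩ := Nat.exists_eq_succ_of_ne_zero hm0
      have h1 : l * (2 * D) * ρ (S ∩ Ω) ≤ μ S :=
        mul_measure_gridCell_inter_highSet_le hidx hnest hle hmin
      have h2 : μ S ≤ l * (D * ρ S) := by
        calc μ S ≤ μ (gridCell idx k x) :=
              measure_mono (gridCell_subset_of_le hnest k.le_succ x)
          _ ≤ l * ρ (gridCell idx k x) := not_lt.1 (hmin k k.lt_succ_self)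
          _ ≤ l * (D * ρ S) := by gcongr; exact hdoub k x
      have h3 : 2 * ρ (S ∩ Ω) ≤ ρ S := by
        have h4 : (l * D) * (2 * ρ (S ∩ Ω)) ≤ (l * D) * ρ S := by
          calc (l * D) * (2 * ρ (S ∩ Ω)) = l * (2 * D) * ρ (S ∩ Ω) := by ring
            _ ≤ l * (D * ρ S) := h1.trans h2
            _ = (l * D) * ρ S := by ring
        exact (ENNReal.mul_le_mul_iff_right (mul_ne_zero hl0 hD0) (ENNReal.mul_ne_top hl hD)).1 h4
      have h5 : ρ S ≤ 2 * ρ (S \ Ω) := by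
        have h6 := measure_inter_add_sdiff (μ := ρ) S hΩm
        have hfin : ρ (S ∩ Ω) ≠ ∞ := measure_ne_top_of_subset inter_subset_left (hρ _ _)
        have h7 : ρ (S ∩ Ω) + ρ (S ∩ Ω) ≤ ρ (S ∩ Ω) + ρ (S \ Ω) := by
          rw [h6, ← two_mul]; exact h3
        have h8 := (ENNReal.add_le_add_iff_left hfin).1 h7
        rw [← h6, two_mul]
        gcongr
      have h9 := hA (k + 1) x (S \ Ω) sdiff_subset (hSm.diff hΩm) h5
      have h10 := measure_inter_add_sdiff (μ := μ) S hΩm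
      have hfin : δ * μ S ≠ ∞ := ENNReal.mul_ne_top hδ (hμ _ _)
      refine (ENNReal.add_le_add_iff_right hfin).1 ?_
      calc μ (S ∩ Ω) + δ * μ S ≤ μ (S ∩ Ω) + μ (S \ Ω) := by gcongr
        _ = 1 * μ S := by rw [h10, one_mul]
        _ ≤ (θ + δ) * μ S := by gcongr
        _ = θ * μ S + δ * μ S := by ring
  refine le_trans (measure_mono ?_) key
  rintro y ⟨hy1, hy2⟩
  exact ⟨⟨hy1, highSet_anti hle hy2⟩, hy2⟩

end Grid

/-- Dyadic layer-cake bound for `y ^ r` along the geometric levels `l * a ^ k`. -/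
theorem rpow_le_mul_one_add_tsum {l a r : ℝ} (hl : 0 < l) (ha : 1 < a) (hr : 0 < r)
    {y : ℝ≥0∞} (hy : y ≠ ∞) {Ω : ℕ → Prop} [DecidablePred Ω]
    (hΩ : ∀ k, ENNReal.ofReal (l * a ^ k) < y → Ω k) :
    y ^ r ≤ ENNReal.ofReal l ^ r *
      (1 + ∑' k, ENNReal.ofReal ((a ^ r - 1) * (a ^ r) ^ k) * (if Ω k then 1 else 0)) := by
  have ht : 1 < a ^ r := Real.one_lt_rpow ha hr
  obtain ⟨x, hx0, rfl⟩ : ∃ x : ℝ, 0 ≤ x ∧ y = ENNReal.ofReal x :=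
    ⟨y.toReal, ENNReal.toReal_nonneg, (ENNReal.ofReal_toReal hy).symm⟩
  classical
  have hex : ∃ k : ℕ, x ≤ l * a ^ k := by
    obtain ⟨k, hk⟩ := pow_unbounded_of_one_lt (x / l) ha
    exact ⟨k, by rw [div_lt_iff₀ hl] at hk; linarith⟩
  rcases hK : Nat.find hex with _ | K
  · have h := Nat.find_spec hex
    rw [hK, pow_zero, mul_one] at h
    calc ENNReal.ofReal x ^ r ≤ ENNReal.ofReal l ^ r * 1 := by rw [mul_one]; gcongr
      _ ≤ _ := by gcongr; exact le_self_add
  · have h := Nat.find_spec hex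
    rw [hK] at h
    have hlow : ∀ k < K + 1, Ω k := by
      intro k hk
      have h1 := Nat.find_min hex (hK ▸ hk)
      rw [not_le] at h1
      exact hΩ k ((ENNReal.ofReal_lt_ofReal_iff (lt_of_le_of_lt (by positivity) h1)).2 h1)
    have hsum : ENNReal.ofReal ((a ^ r) ^ (K + 1)) ≤
        1 + ∑' k, ENNReal.ofReal ((a ^ r - 1) * (a ^ r) ^ k) * (if Ω k then 1 else 0) := by
      calc ENNReal.ofReal ((a ^ r) ^ (K + 1))
          = ENNReal.ofReal (1 + ∑ k ∈ Finset.range (K + 1), (a ^ r - 1) * (a ^ r) ^ k) := by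
            rw [← Finset.mul_sum, mul_geom_sum]; ring_nf
        _ = 1 + ∑ k ∈ Finset.range (K + 1), ENNReal.ofReal ((a ^ r - 1) * (a ^ r) ^ k) := by
            have hnn : ∀ k, 0 ≤ (a ^ r - 1) * (a ^ r) ^ k := fun k =>
              mul_nonneg (by linarith) (by positivity)
            rw [ENNReal.ofReal_add zero_le_one (Finset.sum_nonneg fun k _ => hnn k),
              ENNReal.ofReal_one, ENNReal.ofReal_sum_of_nonneg fun k _ => hnn k]
        _ = 1 + ∑ k ∈ Finset.range (K + 1),
              ENNReal.ofReal ((a ^ r - 1) * (a ^ r) ^ k) * (if Ω k then 1 else 0) := by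
            congr 1
            refine Finset.sum_congr rfl fun k hk => ?_
            rw [if_pos (hlow k (Finset.mem_range.1 hk)), mul_one]
        _ ≤ _ := by gcongr; exact ENNReal.sum_le_tsum _
    calc ENNReal.ofReal x ^ r ≤ ENNReal.ofReal (l * a ^ (K + 1)) ^ r := by gcongr
      _ = ENNReal.ofReal l ^ r * ENNReal.ofReal ((a ^ r) ^ (K + 1)) := by
          have ha0 : 0 ≤ a := by linarith
          rw [ENNReal.ofReal_mul hl.le, ENNReal.mul_rpow_of_nonneg _ _ hr.le,
            ENNReal.ofReal_rpow_of_nonneg (x := a ^ (K + 1)) (by positivity) hr.le,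
            ← Real.rpow_natCast, ← Real.rpow_mul ha0, mul_comm _ r, Real.rpow_mul ha0, Real.rpow_natCast]
      _ ≤ _ := by gcongr

/-- Reverse Hölder inequality on a nested grid of cells, with exponent inversely proportional to
the constant `L` in the `A_∞` condition. -/
theorem lintegral_rpow_gridCell_le {X ι : Type*} [MeasurableSpace X] {ρ : Measure X}
    {idx : ℕ → X → ι} [MeasurableSpace ι] [DiscreteMeasurableSpace ι] [Countable ι]
    (hidx : ∀ m, Measurable (idx m))
    (hnest : ∀ m x y, idx (m + 1) y = idx (m + 1) x → idx m y = idx m x)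
    {d : ℝ} (hd : 1 ≤ d)
    (hdoub : ∀ m x, ρ (gridCell idx m x) ≤ ENNReal.ofReal d * ρ (gridCell idx (m + 1) x))
    (hρ0 : ∀ m x, ρ (gridCell idx m x) ≠ 0) (hρ : ∀ m x, ρ (gridCell idx m x) ≠ ∞)
    {g : X → ℝ≥0∞} (hg : AEMeasurable g ρ) (hgtop : ∀ x, g x ≠ ∞)
    (hμ0 : ∀ m x, ρ.withDensity g (gridCell idx m x) ≠ 0)
    (hμ : ∀ m x, ρ.withDensity g (gridCell idx m x) ≠ ∞)
    {L : ℝ} (hL : 0 < L)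
    (hA : ∀ m x, ∀ E ⊆ gridCell idx m x, MeasurableSet E → ρ (gridCell idx m x) ≤ 2 * ρ E →
      ρ.withDensity g (gridCell idx m x) ≤ ENNReal.ofReal L * ρ.withDensity g E)
    (x₀ : X)
    (hdiff : ∀ᵐ x ∂ρ, x ∈ gridCell idx 0 x₀ →
      Tendsto (fun m => ρ.withDensity g (gridCell idx m x) / ρ (gridCell idx m x)) atTop
        (nhds (g x)))
    {r : ℝ} (hr : 0 < r) (hrL : r * (4 * d * L) ≤ 1) :
    ∫⁻ x in gridCell idx 0 x₀, g x ^ (1 + r) ∂ρ ≤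
      2 * ((ρ.withDensity g (gridCell idx 0 x₀) / ρ (gridCell idx 0 x₀)) ^ r *
        ρ.withDensity g (gridCell idx 0 x₀)) := by
  classical
  set μ := ρ.withDensity g with hμdef
  set Q := gridCell idx 0 x₀ with hQ
  have hQm : MeasurableSet Q := measurableSet_gridCell hidx _ _
  -- the constant is at least one
  have hL1 : 1 ≤ L := by
    have h := hA 0 x₀ Q Subset.rfl hQm (by
      rw [two_mul]; exact le_self_add)
    have h' : 1 * μ Q ≤ ENNReal.ofReal L * μ Q := by rwa [one_mul]
    rw [ENNReal.mul_le_mul_iff_left (hμ0 _ _) (hμ _ _)] at h'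
    simpa using h'
  -- elementary facts on the parameters
  set a : ℝ := 2 * d with ha
  have ha1 : 1 < a := by rw [ha]; linarith
  set t : ℝ := a ^ r with ht
  have ht1 : 1 < t := Real.one_lt_rpow ha1 hr
  have hr1 : r ≤ 1 := by nlinarith [mul_le_mul hd hL1 zero_le_one (by linarith)]
  have hδ : 0 < 1 / L := by positivity
  have hδ1 : 1 / L ≤ 1 := by rw [div_le_one hL]; exact hL1
  have htδ : t - 1 ≤ 1 / L / 2 := by
    have h1 : (1 + (a - 1)) ^ r ≤ 1 + r * (a - 1) :=
      rpow_one_add_le_one_add_mul_self (by linarith) hr.le hr1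
    rw [show 1 + (a - 1) = a by ring] at h1
    have h2 : r * a ≤ 1 / L / 2 := by
      rw [div_div, le_div_iff₀ (by positivity), ha]
      linarith
    linarith
  set θ : ℝ := 1 - 1 / L with hθ
  have hθ0 : 0 ≤ θ := by rw [hθ]; linarith
  have hgap : t - 1 ≤ 1 - t * θ := by
    rw [hθ]; nlinarith
  have htθ : t * θ < 1 := by linarith
  -- the base level
  set l : ℝ := (μ Q / ρ Q).toReal with hl
  have hltop : μ Q / ρ Q ≠ ∞ := ENNReal.div_ne_top (hμ _ _) (hρ0 _ _)
  have hl0 : 0 < l := ENNReal.toReal_pos (ENNReal.div_ne_zero.2 ⟨hμ0 _ _, hρ _ _⟩) hltop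
  have hofl : ENNReal.ofReal l = μ Q / ρ Q := ENNReal.ofReal_toReal hltop
  set Ω : ℕ → Set X := fun k => highSet ρ μ idx (ENNReal.ofReal (l * a ^ k)) with hΩ
  have hΩm : ∀ k, MeasurableSet (Ω k) := fun k => measurableSet_highSet hidx _
  have hdecay : ∀ k, μ (Q ∩ Ω k) ≤ ENNReal.ofReal θ ^ k * μ Q := by
    intro k
    induction k with
    | zero => simpa using measure_mono inter_subset_left
    | succ k ih =>
      have hlk : 0 < l * a ^ k := by positivity
      have h := measure_highSet_mul_le (ρ := ρ) (μ := μ) hidx hnest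
        (D := ENNReal.ofReal d) (by simp; linarith) ENNReal.ofReal_ne_top hdoub hρ hμ
        (δ := ENNReal.ofReal (1 / L)) (θ := ENNReal.ofReal θ) ENNReal.ofReal_ne_top
        (by rw [← ENNReal.ofReal_add hθ0 hδ.le, hθ]; simp)
        (fun m x E hE hEm hEρ => by
          rw [one_div, ENNReal.ofReal_inv_of_pos hL, mul_comm, ← div_eq_mul_inv]
          refine ENNReal.div_le_of_le_mul ?_
          rw [mul_comm]
          exact hA m x E hE hEm hEρ)
        (x₀ := x₀) (l := ENNReal.ofReal (l * a ^ k)) (by simpa using hlk) ENNReal.ofReal_ne_top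
        (by
          calc μ Q = ENNReal.ofReal l * ρ Q := by
                rw [hofl, ENNReal.div_mul_cancel (hρ0 _ _) (hρ _ _)]
            _ ≤ _ := by
                gcongr
                exact le_mul_of_one_le_right hl0.le (one_le_pow₀ ha1.le))
        (by simpa using hd)
      have hlev : ENNReal.ofReal (l * a ^ k) * (2 * ENNReal.ofReal d) =
          ENNReal.ofReal (l * a ^ (k + 1)) := by
        rw [show (2 : ℝ≥0∞) = ENNReal.ofReal 2 by simp, ← ENNReal.ofReal_mul (by norm_num),
          ← ENNReal.ofReal_mul hlk.le, ha]
        congr 1; ring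
      rw [hlev] at h
      calc μ (Q ∩ Ω (k + 1)) ≤ ENNReal.ofReal θ * μ (Q ∩ Ω k) := h
        _ ≤ ENNReal.ofReal θ * (ENNReal.ofReal θ ^ k * μ Q) := by gcongr
        _ = _ := by ring
  -- pointwise bound
  set c : ℕ → ℝ≥0∞ := fun k => ENNReal.ofReal ((t - 1) * t ^ k) with hc
  have hpt : ∀ᵐ x ∂(μ.restrict Q), g x ^ r ≤
      ENNReal.ofReal l ^ r * (1 + ∑' k, c k * (Ω k).indicator 1 x) := by
    rw [ae_restrict_iff' hQm]
    filter_upwards [(withDensity_absolutelyContinuous ρ g).ae_le hdiff] with x hx hxQ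
    have h := rpow_le_mul_one_add_tsum hl0 ha1 hr (hgtop x) (Ω := fun k => x ∈ Ω k) (by
      intro k hk
      obtain ⟨m, hm⟩ := ((hx hxQ).eventually (lt_mem_nhds hk)).exists
      exact ⟨m, (ENNReal.lt_div_iff_mul_lt (Or.inl (hρ0 _ _)) (Or.inl (hρ _ _))).1 hm⟩)
    refine h.trans (le_of_eq ?_)
    simp only [hc, indicator_apply, Pi.one_apply]
    rfl
  have hsum : ∑' k, c k * ENNReal.ofReal θ ^ k ≤ 1 := by
    have hts : HasSum (fun k => (t - 1) * (t * θ) ^ k) ((t - 1) * (1 - t * θ)⁻¹) :=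
      (hasSum_geometric_of_lt_one (by positivity) htθ).mul_left _
    have heq : ∀ k, c k * ENNReal.ofReal θ ^ k = ENNReal.ofReal ((t - 1) * (t * θ) ^ k) := by
      intro k
      rw [hc, ← ENNReal.ofReal_pow hθ0, ← ENNReal.ofReal_mul
        (mul_nonneg (by linarith) (by positivity)), mul_pow, mul_assoc]
    simp only [heq]
    rw [← ENNReal.ofReal_tsum_of_nonneg
      (fun k => mul_nonneg (by linarith) (by positivity)) hts.summable, hts.tsum_eq,
      ← div_eq_mul_inv]
    simp only [ENNReal.ofReal_le_one]
    rw [div_le_one (by linarith)]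
    exact hgap
  calc ∫⁻ x in Q, g x ^ (1 + r) ∂ρ = ∫⁻ x in Q, g x ^ r ∂μ := by
        rw [hμdef, restrict_withDensity hQm,
          lintegral_withDensity_eq_lintegral_mul₀ hg.restrict (hg.restrict.pow_const r)]
        refine lintegral_congr fun x => ?_
        rw [Pi.mul_apply, ENNReal.rpow_add_of_nonneg _ _ zero_le_one hr.le, ENNReal.rpow_one]
    _ ≤ ∫⁻ x in Q, ENNReal.ofReal l ^ r * (1 + ∑' k, c k * (Ω k).indicator 1 x) ∂μ :=
        lintegral_mono_ae hpt
    _ = ENNReal.ofReal l ^ r * (μ Q + ∑' k, c k * μ (Q ∩ Ω k)) := by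
        have hmk : ∀ k, Measurable fun x => c k * (Ω k).indicator (1 : X → ℝ≥0∞) x := fun k =>
          (measurable_one.indicator (hΩm k)).const_mul _
        have hms : Measurable fun x => 1 + ∑' k, c k * (Ω k).indicator (1 : X → ℝ≥0∞) x :=
          measurable_const.add (Measurable.tsum hmk)
        rw [lintegral_const_mul _ hms,
          lintegral_add_left measurable_const, lintegral_tsum fun k => (hmk k).aemeasurable]
        congr 2
        · simp
        · refine tsum_congr fun k => ?_
          rw [lintegral_const_mul _ (measurable_one.indicator (hΩm k)),
            lintegral_indicator_one (hΩm k), Measure.restrict_apply (hΩm k), inter_comm]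
    _ ≤ ENNReal.ofReal l ^ r * (μ Q + ∑' k, c k * (ENNReal.ofReal θ ^ k * μ Q)) := by
        gcongr with k
        exact hdecay k
    _ = ENNReal.ofReal l ^ r * (μ Q + (∑' k, c k * ENNReal.ofReal θ ^ k) * μ Q) := by
        rw [← ENNReal.tsum_mul_right]
        simp only [mul_assoc]
    _ ≤ ENNReal.ofReal l ^ r * (μ Q + 1 * μ Q) := by gcongr
    _ = 2 * ((μ Q / ρ Q) ^ r * μ Q) := by rw [hofl]; ring

/-- Index of the dyadic cell of generation `m` containing `x`, in the grid of base point `b` and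
base side `s`. -/
def dyadicIdx {n : ℕ} (b : Fin n → ℝ) (s : ℝ) (m : ℕ) (x : Fin n → ℝ) : Fin n → ℤ :=
  fun i => ⌊(x i - b i) / s * 2 ^ m⌋

/-- Center of the dyadic cell of generation `m` containing `x`. -/
def dyadicCenter {n : ℕ} (b : Fin n → ℝ) (s : ℝ) (m : ℕ) (x : Fin n → ℝ) : Fin n → ℝ :=
  fun i => b i + ((dyadicIdx b s m x i : ℝ) + 1 / 2) * (s / 2 ^ m)

section Dyadic

variable {n : ℕ} {b : Fin n → ℝ} {s : ℝ}

theorem measurable_dyadicIdx (m : ℕ) : Measurable (dyadicIdx b s m) := by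
  refine measurable_pi_lambda _ fun i => ?_
  exact Int.measurable_floor.comp (by fun_prop)

theorem dyadicIdx_nested (m : ℕ) (x y : Fin n → ℝ)
    (h : dyadicIdx b s (m + 1) y = dyadicIdx b s (m + 1) x) :
    dyadicIdx b s m y = dyadicIdx b s m x := by
  have key : ∀ z : Fin n → ℝ, ∀ i, dyadicIdx b s m z i = dyadicIdx b s (m + 1) z i / 2 := by
    intro z i
    have := Int.floor_div_natCast ((z i - b i) / s * 2 ^ (m + 1)) 2
    rw [dyadicIdx, dyadicIdx]
    push_cast at this
    rw [← this]
    congr 1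
    rw [pow_succ]; ring
  funext i
  rw [key, key, h]

theorem gridCell_dyadicIdx (hs : 0 < s) (m : ℕ) (x : Fin n → ℝ) :
    gridCell (dyadicIdx b s) m x = univ.pi fun i =>
      Ico (dyadicCenter b s m x i - s / 2 / 2 ^ m) (dyadicCenter b s m x i + s / 2 / 2 ^ m) := by
  ext y
  simp only [gridCell, mem_ofPred_eq, Set.mem_pi, mem_univ, true_imp_iff, funext_iff, mem_Ico]
  refine forall_congr' fun i => ?_
  have h2 : (0 : ℝ) < 2 ^ m := by positivity
  have hsm : 0 < s / 2 ^ m := by positivity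
  have e : (y i - b i) / s * 2 ^ m = (y i - b i) / (s / 2 ^ m) := by
    field_simp
  have hu : dyadicIdx b s m y i = ⌊(y i - b i) / (s / 2 ^ m)⌋ := by rw [dyadicIdx, e]
  have h3 : s / 2 / 2 ^ m = (s / 2 ^ m) / 2 := by ring
  rw [hu, Int.floor_eq_iff, le_div_iff₀ hsm, div_lt_iff₀ hsm, h3]
  simp only [dyadicCenter]
  constructor <;> rintro ⟨h, h'⟩ <;> constructor <;> linarith

theorem Icc_pi_eq_closedBall (z : Fin n → ℝ) {t : ℝ} (ht : 0 ≤ t) :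
    Icc (fun i => z i - t) (fun i => z i + t) = Metric.closedBall z t := by
  rw [closedBall_pi _ ht, ← pi_univ_Icc]
  simp only [Real.closedBall_eq_Icc]

theorem gridCell_dyadicIdx_ae_eq (hs : 0 < s) (m : ℕ) (x : Fin n → ℝ) :
    gridCell (dyadicIdx b s) m x =ᵐ[volume]
      Metric.closedBall (dyadicCenter b s m x) (s / 2 / 2 ^ m) := by
  rw [gridCell_dyadicIdx hs, ← Icc_pi_eq_closedBall _ (by positivity)]
  exact Measure.univ_pi_Ico_ae_eq_Icc

theorem gridCell_dyadicIdx_subset (hs : 0 < s) (m : ℕ) (x : Fin n → ℝ) :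
    gridCell (dyadicIdx b s) m x ⊆
      Metric.closedBall (dyadicCenter b s m x) (s / 2 / 2 ^ m) := by
  rw [gridCell_dyadicIdx hs, ← Icc_pi_eq_closedBall _ (by positivity), ← pi_univ_Icc]
  exact pi_mono fun i _ => Ico_subset_Icc_self

theorem volume_gridCell_dyadicIdx (hs : 0 < s) (m : ℕ) (x : Fin n → ℝ) :
    volume (gridCell (dyadicIdx b s) m x) = ENNReal.ofReal ((s / 2 ^ m) ^ n) := by
  rw [measure_congr (gridCell_dyadicIdx_ae_eq hs m x), Real.volume_pi_closedBall _ (by positivity)]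
  simp only [Fintype.card_fin]
  congr 2
  ring

end Dyadic

/-- Sharp reverse Hölder inequality for a density satisfying an `A_∞` condition on all cubes. -/
theorem lintegral_rpow_closedBall_le {n : ℕ} {g : (Fin n → ℝ) → ℝ≥0∞}
    (hg : AEMeasurable g volume) (hgtop : ∀ x, g x ≠ ∞)
    (hg0 : ∀ c h, 0 < h → ∫⁻ x in Metric.closedBall c h, g x ≠ 0)
    (hgfin : ∀ c h, 0 < h → ∫⁻ x in Metric.closedBall c h, g x ≠ ∞)
    {L : ℝ} (hL : 0 < L)
    (hA : ∀ c h, 0 < h → ∀ E ⊆ Metric.closedBall c h, MeasurableSet E →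
      volume (Metric.closedBall c h) ≤ 2 * volume E →
      ∫⁻ x in Metric.closedBall c h, g x ≤ ENNReal.ofReal L * ∫⁻ x in E, g x)
    {r : ℝ} (hr : 0 < r) (hrL : r * (4 * 2 ^ n * L) ≤ 1) (c : Fin n → ℝ) {h : ℝ} (hh : 0 < h) :
    ∫⁻ x in Metric.closedBall c h, g x ^ (1 + r) ≤
      2 * (((∫⁻ x in Metric.closedBall c h, g x) / volume (Metric.closedBall c h)) ^ r *
        ∫⁻ x in Metric.closedBall c h, g x) := by
  set b : Fin n → ℝ := fun i => c i - h with hb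
  set s : ℝ := 2 * h with hs
  have hs0 : 0 < s := by positivity
  have hrad : ∀ m : ℕ, 0 < s / 2 / 2 ^ m := fun m => by positivity
  have hcell : ∀ m x, volume.withDensity g (gridCell (dyadicIdx b s) m x) =
      ∫⁻ y in Metric.closedBall (dyadicCenter b s m x) (s / 2 / 2 ^ m), g y := by
    intro m x
    rw [withDensity_apply _ (measurableSet_gridCell measurable_dyadicIdx m x),
      setLIntegral_congr (gridCell_dyadicIdx_ae_eq hs0 m x)]
  have hcenter : dyadicCenter b s 0 c = c := by
    funext i
    have : dyadicIdx b s 0 c i = 0 := by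
      rw [dyadicIdx, Int.floor_eq_zero_iff, hb, hs]
      have : (c i - (c i - h)) / (2 * h) * 2 ^ 0 = 1 / 2 := by field_simp; ring
      rw [this]
      norm_num
    rw [dyadicCenter, this, hb, hs]
    push_cast; ring
  have hball : gridCell (dyadicIdx b s) 0 c =ᵐ[volume] Metric.closedBall c h := by
    have := gridCell_dyadicIdx_ae_eq (b := b) hs0 0 c
    rwa [hcenter, pow_zero, div_one, hs, mul_div_cancel_left₀ _ (two_ne_zero' ℝ)] at this
  have hfin1 : ∫⁻ x, (gridCell (dyadicIdx b s) 0 c).indicator g x ≠ ∞ := by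
    rw [lintegral_indicator (measurableSet_gridCell measurable_dyadicIdx 0 c),
      setLIntegral_congr hball]
    exact hgfin c h hh
  have hdiff : ∀ᵐ x ∂(volume : Measure (Fin n → ℝ)), x ∈ gridCell (dyadicIdx b s) 0 c →
      Tendsto (fun m => volume.withDensity g (gridCell (dyadicIdx b s) m x) /
        volume (gridCell (dyadicIdx b s) m x)) atTop (nhds (g x)) := by
    filter_upwards [(IsUnifLocDoublingMeasure.vitaliFamily
      (volume : Measure (Fin n → ℝ)) 1).ae_tendsto_lintegral_div
      (hg.indicator (measurableSet_gridCell measurable_dyadicIdx 0 c)) hfin1] with x hx hxQ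
    have hlim : Tendsto (fun m : ℕ => s / 2 / 2 ^ m) atTop (nhdsWithin 0 (Ioi 0)) := by
      refine tendsto_nhdsWithin_iff.2 ⟨?_, Eventually.of_forall hrad⟩
      exact tendsto_const_nhds.div_atTop (tendsto_pow_atTop_atTop_of_one_lt one_lt_two)
    have h1 := hx.comp (IsUnifLocDoublingMeasure.tendsto_closedBall_filterAt
      (volume : Measure (Fin n → ℝ)) (K := 1) (x := x)
      (fun m => dyadicCenter b s m x) (fun m : ℕ => s / 2 / 2 ^ m) hlim
      (Eventually.of_forall fun m => by
        rw [one_mul]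
        exact gridCell_dyadicIdx_subset hs0 m x (mem_gridCell_self m x)))
    rw [indicator_of_mem hxQ] at h1
    refine h1.congr fun m => ?_
    have hae := gridCell_dyadicIdx_ae_eq (b := b) hs0 m x
    have hsub : gridCell (dyadicIdx b s) m x ⊆ gridCell (dyadicIdx b s) 0 c := by
      rw [← gridCell_congr hxQ]
      exact gridCell_subset_of_le dyadicIdx_nested (Nat.zero_le m) x
    simp only [Function.comp_apply]
    rw [withDensity_apply _ (measurableSet_gridCell measurable_dyadicIdx m x),
      ← measure_congr hae, ← setLIntegral_congr hae]
    congr 1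
    refine setLIntegral_congr_fun (measurableSet_gridCell measurable_dyadicIdx m x) ?_
    intro y hy
    exact indicator_of_mem (hsub hy) g
  have key := lintegral_rpow_gridCell_le (ρ := (volume : Measure (Fin n → ℝ)))
    (idx := dyadicIdx b s) (d := 2 ^ n) (g := g) (L := L) measurable_dyadicIdx dyadicIdx_nested
    (one_le_pow₀ one_le_two)
    (fun m x => by
      rw [volume_gridCell_dyadicIdx hs0, volume_gridCell_dyadicIdx hs0,
        ← ENNReal.ofReal_mul (by positivity), ← mul_pow]
      refine le_of_eq ?_
      congr 2
      rw [pow_succ]; field_simp)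
    (fun m x => by
      rw [volume_gridCell_dyadicIdx hs0]
      simp only [ne_eq, ENNReal.ofReal_eq_zero, not_le]
      positivity)
    (fun m x => by rw [volume_gridCell_dyadicIdx hs0]; exact ENNReal.ofReal_ne_top)
    hg hgtop
    (fun m x => by rw [hcell]; exact hg0 _ _ (hrad m))
    (fun m x => by rw [hcell]; exact hgfin _ _ (hrad m))
    hL
    (fun m x E hE hEm hEv => by
      rw [hcell, withDensity_apply _ hEm]
      refine hA _ _ (hrad m) E (hE.trans (gridCell_dyadicIdx_subset hs0 m x)) hEm ?_
      rwa [← measure_congr (gridCell_dyadicIdx_ae_eq hs0 m x)])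
    c hdiff hr hrL
  rwa [withDensity_apply _ (measurableSet_gridCell measurable_dyadicIdx 0 c),
    setLIntegral_congr hball, setLIntegral_congr hball, measure_congr hball] at key

theorem sq_mul_rpow_half_mul_rpow_half (x y z : ℝ≥0∞) :
    (x * (y ^ ((1 : ℝ) / 2) * z ^ ((1 : ℝ) / 2))) ^ 2 = x ^ 2 * y * z := by
  have hsq : ∀ u : ℝ≥0∞, (u ^ ((1 : ℝ) / 2)) ^ 2 = u := fun u => by
    rw [← ENNReal.rpow_natCast, ← ENNReal.rpow_mul]
    norm_num
  rw [mul_pow, mul_pow, hsq, hsq, mul_assoc]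

theorem measure_pow_four_le {X : Type*} [MeasurableSpace X] {ρ : Measure X} {v s₁ s₂ : X → ℝ≥0∞}
    (hv : AEMeasurable v ρ) (hs₁ : AEMeasurable s₁ ρ) (hs₂ : AEMeasurable s₂ ρ)
    (hrel : ∀ᵐ x ∂ρ, v x ^ 2 * s₁ x * s₂ x = 1) (E : Set X) :
    ρ E ^ 4 ≤ (∫⁻ x in E, v x ∂ρ) ^ 2 * (∫⁻ x in E, s₁ x ∂ρ) * ∫⁻ x in E, s₂ x ∂ρ := by
  have hpow : ∀ a b c : ℝ≥0∞, (a ^ 2 * b * c) ^ ((1 : ℝ) / 4) =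
      a ^ ((1 : ℝ) / 2) * b ^ ((1 : ℝ) / 4) * c ^ ((1 : ℝ) / 4) := fun a b c => by
    rw [ENNReal.mul_rpow_of_nonneg _ _ (by norm_num), ENNReal.mul_rpow_of_nonneg _ _ (by norm_num),
      ← ENNReal.rpow_natCast, ← ENNReal.rpow_mul]
    norm_num
  have h := ENNReal.lintegral_prod_norm_pow_le (μ := ρ.restrict E) Finset.univ
    (f := ![v, s₁, s₂]) (p := ![1 / 2, 1 / 4, 1 / 4])
    (by
      intro i _
      fin_cases i
      · exact hv.restrict
      · exact hs₁.restrict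
      · exact hs₂.restrict)
    (by simp [Fin.sum_univ_three]; norm_num)
    (by intro i _; fin_cases i <;> simp)
  simp only [Fin.prod_univ_three, Matrix.cons_val_zero, Matrix.cons_val_one,
    Matrix.cons_val_two, Matrix.head_cons, Matrix.tail_cons] at h
  simp only [← hpow] at h
  have h1 : ∫⁻ x in E, (v x ^ 2 * s₁ x * s₂ x) ^ ((1 : ℝ) / 4) ∂ρ = ρ E := by
    rw [← setLIntegral_one]
    refine lintegral_congr_ae (ae_restrict_of_ae ?_)
    filter_upwards [hrel] with x hx
    rw [hx, ENNReal.one_rpow]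
  rw [h1] at h
  calc ρ E ^ 4 ≤ (((∫⁻ x in E, v x ∂ρ) ^ 2 * (∫⁻ x in E, s₁ x ∂ρ) * ∫⁻ x in E, s₂ x ∂ρ) ^
        ((1 : ℝ) / 4)) ^ 4 := by gcongr
    _ = _ := by
      rw [← ENNReal.rpow_natCast, ← ENNReal.rpow_mul]
      norm_num

/-- From the product condition, an `A_∞` condition for a factor entering linearly. -/
theorem le_mul_of_pow_four_le_linear {b e K V S S' T : ℝ≥0∞} (hb0 : b ≠ 0) (hb : b ≠ ∞)
    (hbe : b ≤ 2 * e) (he : e ^ 4 ≤ V ^ 2 * S' * T) (hK : V ^ 2 * S * T ≤ K ^ 2 * b ^ 4) :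
    S ≤ 16 * K ^ 2 * S' := by
  refine (ENNReal.mul_le_mul_iff_left (pow_ne_zero 4 hb0) (ENNReal.pow_ne_top hb)).1 ?_
  calc S * b ^ 4 ≤ S * (2 * e) ^ 4 := by gcongr
    _ = S * (16 * e ^ 4) := by ring
    _ ≤ S * (16 * (V ^ 2 * S' * T)) := by gcongr
    _ = 16 * S' * (V ^ 2 * S * T) := by ring
    _ ≤ 16 * S' * (K ^ 2 * b ^ 4) := by gcongr
    _ = 16 * K ^ 2 * S' * b ^ 4 := by ring

/-- From the product condition, an `A_∞` condition for a factor entering quadratically. -/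
theorem le_mul_of_pow_four_le_quadratic {b e K V V' S T : ℝ≥0∞} (hb0 : b ≠ 0) (hb : b ≠ ∞)
    (hbe : b ≤ 2 * e) (he : e ^ 4 ≤ V' ^ 2 * S * T) (hK : V ^ 2 * S * T ≤ K ^ 2 * b ^ 4)
    (hV0 : V ≠ 0) (hV : V ≠ ∞) (hV' : V' ≤ V) : V ≤ 16 * K ^ 2 * V' := by
  have h := le_mul_of_pow_four_le_linear (V := 1) (S := V ^ 2) (S' := V' ^ 2) (T := S * T)
    (K := K) hb0 hb hbe (by rw [one_pow, one_mul, ← mul_assoc]; exact he)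
    (by rw [one_pow, one_mul, ← mul_assoc]; exact hK)
  refine (ENNReal.mul_le_mul_iff_left hV0 hV).1 ?_
  calc V * V = V ^ 2 := by ring
    _ ≤ 16 * K ^ 2 * V' ^ 2 := h
    _ = 16 * K ^ 2 * V' * V' := by ring
    _ ≤ 16 * K ^ 2 * V' * V := by gcongr

theorem mul_rpow_half_le_of_le {x y z x' y' z' : ℝ≥0∞} {p : ℝ} (hp : 0 ≤ p)
    (hx : x' ≤ 2 * x ^ p) (hy : y' ≤ 2 * y ^ p) (hz : z' ≤ 2 * z ^ p) :
    x' * (y' ^ ((1 : ℝ) / 2) * z' ^ ((1 : ℝ) / 2)) ≤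
      4 * (x * (y ^ ((1 : ℝ) / 2) * z ^ ((1 : ℝ) / 2))) ^ p := by
  have hhalf : (0 : ℝ) ≤ 1 / 2 := by norm_num
  have h2 : (2 : ℝ≥0∞) ^ ((1 : ℝ) / 2) * 2 ^ ((1 : ℝ) / 2) = 2 := by
    rw [← ENNReal.rpow_add_of_nonneg _ _ hhalf hhalf]
    norm_num
  have hcomm : ∀ u : ℝ≥0∞, (u ^ p) ^ ((1 : ℝ) / 2) = (u ^ ((1 : ℝ) / 2)) ^ p := fun u => by
    rw [← ENNReal.rpow_mul, ← ENNReal.rpow_mul, mul_comm]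
  calc x' * (y' ^ ((1 : ℝ) / 2) * z' ^ ((1 : ℝ) / 2))
      ≤ (2 * x ^ p) * ((2 * y ^ p) ^ ((1 : ℝ) / 2) * (2 * z ^ p) ^ ((1 : ℝ) / 2)) := by gcongr
    _ = 2 * (2 ^ ((1 : ℝ) / 2) * 2 ^ ((1 : ℝ) / 2)) *
          (x ^ p * ((y ^ ((1 : ℝ) / 2)) ^ p * (z ^ ((1 : ℝ) / 2)) ^ p)) := by
        rw [ENNReal.mul_rpow_of_nonneg _ _ hhalf, ENNReal.mul_rpow_of_nonneg _ _ hhalf,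
          hcomm, hcomm]
        ring
    _ = _ := by
        rw [h2, ENNReal.mul_rpow_of_nonneg _ _ hp, ENNReal.mul_rpow_of_nonneg _ _ hp]
        norm_num

theorem lintegral_rpow_div_le {n : ℕ} {g : (Fin n → ℝ) → ℝ≥0∞} {B : Set (Fin n → ℝ)} {r : ℝ}
    (hr : 0 < r) (h : ∫⁻ x in B, g x ^ (1 + r) ≤
      2 * (((∫⁻ x in B, g x) / volume B) ^ r * ∫⁻ x in B, g x)) :
    (∫⁻ x in B, g x ^ (1 + r)) / volume B ≤ 2 * ((∫⁻ x in B, g x) / volume B) ^ (1 + r) := by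
  calc (∫⁻ x in B, g x ^ (1 + r)) / volume B
      ≤ (2 * (((∫⁻ x in B, g x) / volume B) ^ r * ∫⁻ x in B, g x)) / volume B := by gcongr
    _ = _ := by
        rw [ENNReal.rpow_add_of_nonneg _ _ zero_le_one hr.le, ENNReal.rpow_one]
        simp only [div_eq_mul_inv]
        ring

/-- The bilinear reverse Hölder inequality for densities on `Fin n → ℝ`. -/
theorem bilinear_reverse_holder_closedBall {n : ℕ} {v s₁ s₂ : (Fin n → ℝ) → ℝ≥0∞}
    (hv : AEMeasurable v volume) (hs₁ : AEMeasurable s₁ volume) (hs₂ : AEMeasurable s₂ volume)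
    (hvtop : ∀ x, v x ≠ ∞) (hs₁top : ∀ x, s₁ x ≠ ∞) (hs₂top : ∀ x, s₂ x ≠ ∞)
    (hrel : ∀ᵐ x, v x ^ 2 * s₁ x * s₂ x = 1) {K : ℝ} (hK : 0 < K)
    (hA : ∀ (c : Fin n → ℝ) (h : ℝ), 0 < h →
      (∫⁻ x in Metric.closedBall c h, v x) / volume (Metric.closedBall c h) *
        (((∫⁻ x in Metric.closedBall c h, s₁ x) / volume (Metric.closedBall c h)) ^ ((1 : ℝ) / 2) *
          ((∫⁻ x in Metric.closedBall c h, s₂ x) / volume (Metric.closedBall c h)) ^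
            ((1 : ℝ) / 2)) ≤ ENNReal.ofReal K)
    {r : ℝ} (hr : 0 < r) (hrK : r * (64 * 2 ^ n * K ^ 2) ≤ 1)
    (c : Fin n → ℝ) {h : ℝ} (hh : 0 < h) :
    (∫⁻ x in Metric.closedBall c h, v x ^ (1 + r)) / volume (Metric.closedBall c h) *
      (((∫⁻ x in Metric.closedBall c h, s₁ x ^ (1 + r)) / volume (Metric.closedBall c h)) ^
          ((1 : ℝ) / 2) *
        ((∫⁻ x in Metric.closedBall c h, s₂ x ^ (1 + r)) / volume (Metric.closedBall c h)) ^
          ((1 : ℝ) / 2)) ≤ 4 * ENNReal.ofReal K ^ (1 + r) := by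
  have hb0 : ∀ (c : Fin n → ℝ) (h : ℝ), 0 < h → volume (Metric.closedBall c h) ≠ 0 :=
    fun c h hh => (Metric.measure_closedBall_pos volume c hh).ne'
  have hb : ∀ (c : Fin n → ℝ) (h : ℝ), volume (Metric.closedBall c h) ≠ ∞ :=
    fun c h => measure_closedBall_lt_top.ne
  have hprod : ∀ (c : Fin n → ℝ) (h : ℝ), 0 < h →
      (∫⁻ x in Metric.closedBall c h, v x) ^ 2 * (∫⁻ x in Metric.closedBall c h, s₁ x) *
        (∫⁻ x in Metric.closedBall c h, s₂ x) ≤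
          ENNReal.ofReal K ^ 2 * volume (Metric.closedBall c h) ^ 4 := by
    intro c h hh
    have h1 := pow_le_pow_left₀ zero_le (hA c h hh) 2
    rw [sq_mul_rpow_half_mul_rpow_half] at h1
    have hdiv : ∀ u : ℝ≥0∞, u / volume (Metric.closedBall c h) *
        volume (Metric.closedBall c h) = u := fun u =>
      ENNReal.div_mul_cancel (hb0 c h hh) (hb c h)
    conv_lhs => rw [← hdiv (∫⁻ x in Metric.closedBall c h, v x),
      ← hdiv (∫⁻ x in Metric.closedBall c h, s₁ x), ← hdiv (∫⁻ x in Metric.closedBall c h, s₂ x)]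
    refine le_trans (le_of_eq ?_) (mul_le_mul_left h1 (volume (Metric.closedBall c h) ^ 4))
    ring
  have hne : ∀ (u : (Fin n → ℝ) → ℝ≥0∞), AEMeasurable u volume → (∀ᵐ x, u x ≠ 0) →
      ∀ (c : Fin n → ℝ) (h : ℝ), 0 < h → ∫⁻ x in Metric.closedBall c h, u x ≠ 0 := by
    intro u hu hu0 c h hh h0
    rw [lintegral_eq_zero_iff' hu.restrict] at h0
    have h1 : ∀ᵐ x ∂(volume.restrict (Metric.closedBall c h)), False := by
      filter_upwards [h0, ae_restrict_of_ae hu0] with x hx hx'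
      exact hx' hx
    rw [ae_iff] at h1
    simp only [not_false_eq_true, ofPred_true, Measure.restrict_apply_univ] at h1
    exact hb0 c h hh h1
  have hv0 := hne v hv (by
    filter_upwards [hrel] with x hx h0
    simp [h0] at hx)
  have hs₁0 := hne s₁ hs₁ (by
    filter_upwards [hrel] with x hx h0
    simp [h0] at hx)
  have hs₂0 := hne s₂ hs₂ (by
    filter_upwards [hrel] with x hx h0
    simp [h0] at hx)
  have hprodtop : ∀ (c : Fin n → ℝ) (h : ℝ), 0 < h →
      (∫⁻ x in Metric.closedBall c h, v x) ^ 2 * (∫⁻ x in Metric.closedBall c h, s₁ x) *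
        (∫⁻ x in Metric.closedBall c h, s₂ x) ≠ ∞ := fun c h hh =>
    ne_top_of_le_ne_top (ENNReal.mul_ne_top (by simp) (ENNReal.pow_ne_top (hb c h))) (hprod c h hh)
  have hvfin : ∀ (c : Fin n → ℝ) (h : ℝ), 0 < h → ∫⁻ x in Metric.closedBall c h, v x ≠ ∞ := by
    intro c h hh htop
    refine hprodtop c h hh ?_
    rw [htop, ENNReal.top_pow two_ne_zero, ENNReal.top_mul (hs₁0 c h hh),
      ENNReal.top_mul (hs₂0 c h hh)]
  have hs₁fin : ∀ (c : Fin n → ℝ) (h : ℝ), 0 < h → ∫⁻ x in Metric.closedBall c h, s₁ x ≠ ∞ := by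
    intro c h hh htop
    refine hprodtop c h hh ?_
    rw [htop, ENNReal.mul_top (pow_ne_zero 2 (hv0 c h hh)), ENNReal.top_mul (hs₂0 c h hh)]
  have hs₂fin : ∀ (c : Fin n → ℝ) (h : ℝ), 0 < h → ∫⁻ x in Metric.closedBall c h, s₂ x ≠ ∞ := by
    intro c h hh htop
    refine hprodtop c h hh ?_
    rw [htop, ENNReal.mul_top (mul_ne_zero (pow_ne_zero 2 (hv0 c h hh)) (hs₁0 c h hh))]
  have hL : 0 < 16 * K ^ 2 := by positivity
  have hofL : ENNReal.ofReal (16 * K ^ 2) = 16 * ENNReal.ofReal K ^ 2 := by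
    rw [ENNReal.ofReal_mul (by norm_num), ENNReal.ofReal_pow hK.le]
    norm_num
  have hrL : r * (4 * 2 ^ n * (16 * K ^ 2)) ≤ 1 := by
    refine le_trans (le_of_eq ?_) hrK
    ring
  have hhol := measure_pow_four_le hv hs₁ hs₂ hrel
  have hvRH := lintegral_rpow_div_le hr <| lintegral_rpow_closedBall_le hv hvtop hv0 hvfin hL
    (fun c h hh E hE _ hEv => by
      rw [hofL]
      refine le_mul_of_pow_four_le_quadratic (hb0 c h hh) (hb c h) hEv ((hhol E).trans ?_)
        (hprod c h hh) (hv0 c h hh) (hvfin c h hh) (lintegral_mono_set hE)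
      gcongr) hr hrL c hh
  have hs₁RH := lintegral_rpow_div_le hr <| lintegral_rpow_closedBall_le hs₁ hs₁top hs₁0 hs₁fin hL
    (fun c h hh E hE _ hEv => by
      rw [hofL]
      refine le_mul_of_pow_four_le_linear (hb0 c h hh) (hb c h) hEv ((hhol E).trans ?_)
        (hprod c h hh)
      gcongr) hr hrL c hh
  have hs₂RH := lintegral_rpow_div_le hr <| lintegral_rpow_closedBall_le hs₂ hs₂top hs₂0 hs₂fin hL
    (fun c h hh E hE _ hEv => by
      rw [hofL]
      refine le_mul_of_pow_four_le_linear (V := ∫⁻ x in Metric.closedBall c h, v x)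
        (T := ∫⁻ x in Metric.closedBall c h, s₁ x) (hb0 c h hh) (hb c h) hEv ((hhol E).trans ?_)
        (by rw [mul_right_comm]; exact hprod c h hh)
      rw [mul_right_comm]
      gcongr) hr hrL c hh
  refine (mul_rpow_half_le_of_le (by linarith) hvRH hs₁RH hs₂RH).trans ?_
  gcongr
  exact hA c h hh

theorem setLIntegral_cube_div {n : ℕ} (f : Euc n → ℝ≥0∞) (c : Euc n) {h : ℝ} (hh : 0 ≤ h) :
    (∫⁻ x in cube c h, f x) / volume (cube c h) =
      (∫⁻ y in Metric.closedBall (WithLp.ofLp c) h, f (WithLp.toLp 2 y)) /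
        volume (Metric.closedBall (WithLp.ofLp c) h) := by
  have hmp := EuclideanSpace.volume_preserving_symm_measurableEquiv_toLp (Fin n)
  have hpre : cube c h = (MeasurableEquiv.toLp 2 (Fin n → ℝ)).symm ⁻¹'
      Metric.closedBall (WithLp.ofLp c) h := by
    ext x
    rw [mem_preimage, closedBall_pi _ hh]
    simp only [cube, mem_ofPred_eq, Set.mem_pi, mem_univ, true_imp_iff, Metric.mem_closedBall,
      Real.dist_eq]
    rfl
  rw [hpre, hmp.measure_preimage_equiv,
    ← hmp.setLIntegral_comp_preimage_emb (MeasurableEquiv.measurableEmbedding _)]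
  rfl

/-- Reverse Hölder inequality for multiple weights.
There are `c > 0` and `C ≥ 1` depending only on `n` such that for every
`(ω₁, ω₂) ∈ A_{(2,2)}` and every `0 < r ≤ c·[ω₁,ω₂]^{-2}_{A_{(2,2)}}`, the pair
`(ω₁^{1+r}, ω₂^{1+r})` is in `A_{(2,2)}` with
`[ω₁^{1+r}, ω₂^{1+r}]_{A_{(2,2)}} ≤ C·[ω₁,ω₂]^{1+r}_{A_{(2,2)}}`. -/
theorem a22_reverse_holder (n : ℕ) :
    ∃ c C : ℝ, 0 < c ∧ 1 ≤ C ∧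
      ∀ w1 w2 : Euc n → ℝ, IsWeight w1 → IsWeight w2 → a22Const n w1 w2 < ⊤ →
        ∀ r : ℝ, 0 < r → r ≤ c * (((a22Const n w1 w2).toReal) ^ 2)⁻¹ →
          a22Const n (fun x => w1 x ^ (1 + r)) (fun x => w2 x ^ (1 + r)) < ⊤ ∧
            a22Const n (fun x => w1 x ^ (1 + r)) (fun x => w2 x ^ (1 + r)) ≤
              ENNReal.ofReal C * (a22Const n w1 w2) ^ (1 + r) := by
  refine ⟨1 / (64 * 2 ^ n), 4, by positivity, by norm_num, ?_⟩
  intro w1 w2 hw1 hw2 hfin r hr hrc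
  set K : ℝ := (a22Const n w1 w2).toReal with hK
  have hofK : ENNReal.ofReal K = a22Const n w1 w2 := ENNReal.ofReal_toReal hfin.ne
  have hK0 : 0 < K := by
    rcases (show 0 ≤ K from ENNReal.toReal_nonneg).eq_or_lt with h | h
    · rw [← h] at hrc
      norm_num at hrc
      linarith
    · exact h
  have hrK : r * (64 * 2 ^ n * K ^ 2) ≤ 1 := by
    calc r * (64 * 2 ^ n * K ^ 2)
        ≤ 1 / (64 * 2 ^ n) * (K ^ 2)⁻¹ * (64 * 2 ^ n * K ^ 2) := by gcongr
      _ = 1 := by field_simp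
  have hm1 : AEMeasurable w1 volume := hw1.1.aestronglyMeasurable.aemeasurable
  have hm2 : AEMeasurable w2 volume := hw2.1.aestronglyMeasurable.aemeasurable
  have hmp := (EuclideanSpace.volume_preserving_symm_measurableEquiv_toLp (Fin n)).symm
  set v : Euc n → ℝ≥0∞ := fun x =>
    ENNReal.ofReal (w1 x ^ ((1 : ℝ) / 2) * w2 x ^ ((1 : ℝ) / 2)) with hv
  set s₁ : Euc n → ℝ≥0∞ := fun x => ENNReal.ofReal (w1 x)⁻¹ with hs₁
  set s₂ : Euc n → ℝ≥0∞ := fun x => ENNReal.ofReal (w2 x)⁻¹ with hs₂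
  have hvm : AEMeasurable v volume := ((hm1.pow_const _).mul (hm2.pow_const _)).ennreal_ofReal
  have hs₁m : AEMeasurable s₁ volume := hm1.inv.ennreal_ofReal
  have hs₂m : AEMeasurable s₂ volume := hm2.inv.ennreal_ofReal
  have hrel : ∀ᵐ x, v x ^ 2 * s₁ x * s₂ x = 1 := by
    filter_upwards [hw1.2, hw2.2] with x h1 h2
    have hsq : ∀ u : ℝ, 0 < u → (u ^ ((1 : ℝ) / 2)) ^ 2 = u := fun u hu => by
      rw [← Real.rpow_natCast, ← Real.rpow_mul hu.le]
      norm_num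
    simp only [hv, hs₁, hs₂]
    rw [← ENNReal.ofReal_pow (by positivity), ← ENNReal.ofReal_mul (by positivity),
      ← ENNReal.ofReal_mul (by positivity), mul_pow, hsq _ h1, hsq _ h2, ENNReal.ofReal_eq_one]
    field_simp
  have hinv : ∀ w : Euc n → ℝ, (∀ᵐ x, 0 < w x) → ∀ c h,
      eAvg (fun x => (w x ^ (1 + r))⁻¹) c h =
        (∫⁻ x in cube c h, ENNReal.ofReal (w x)⁻¹ ^ (1 + r)) / volume (cube c h) := by
    intro w hw c h
    rw [eAvg]
    congr 1
    refine lintegral_congr_ae (ae_restrict_of_ae ?_)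
    filter_upwards [hw] with x hx
    rw [ENNReal.ofReal_rpow_of_nonneg (by positivity) (by linarith), Real.inv_rpow hx.le]
  have hvpow : ∀ c h, eAvg (fun x => (w1 x ^ (1 + r)) ^ ((1 : ℝ) / 2) *
      (w2 x ^ (1 + r)) ^ ((1 : ℝ) / 2)) c h =
        (∫⁻ x in cube c h, v x ^ (1 + r)) / volume (cube c h) := by
    intro c h
    rw [eAvg]
    congr 1
    refine lintegral_congr_ae (ae_restrict_of_ae ?_)
    filter_upwards [hw1.2, hw2.2] with x h1 h2
    rw [hv, ENNReal.ofReal_rpow_of_nonneg (by positivity) (by linarith),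
      Real.mul_rpow (by positivity) (by positivity), ← Real.rpow_mul h1.le, ← Real.rpow_mul h2.le,
      ← Real.rpow_mul h1.le, ← Real.rpow_mul h2.le, mul_comm (1 + r)]
  have hmain : a22Const n (fun x => w1 x ^ (1 + r)) (fun x => w2 x ^ (1 + r)) ≤
      ENNReal.ofReal 4 * a22Const n w1 w2 ^ (1 + r) := by
    refine iSup_le fun c => iSup_le fun h => iSup_le fun hh => ?_
    rw [a22Ratio, hvpow, hinv w1 hw1.2, hinv w2 hw2.2, setLIntegral_cube_div _ _ hh.le,
      setLIntegral_cube_div _ _ hh.le, setLIntegral_cube_div _ _ hh.le, ← hofK,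
      show ENNReal.ofReal 4 = 4 by norm_num]
    refine bilinear_reverse_holder_closedBall (v := fun y => v (WithLp.toLp 2 y))
      (s₁ := fun y => s₁ (WithLp.toLp 2 y)) (s₂ := fun y => s₂ (WithLp.toLp 2 y))
      (hvm.comp_quasiMeasurePreserving hmp.quasiMeasurePreserving)
      (hs₁m.comp_quasiMeasurePreserving hmp.quasiMeasurePreserving)
      (hs₂m.comp_quasiMeasurePreserving hmp.quasiMeasurePreserving)
      (fun _ => ENNReal.ofReal_ne_top)
      (fun _ => ENNReal.ofReal_ne_top) (fun _ => ENNReal.ofReal_ne_top)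
      (hmp.quasiMeasurePreserving.ae hrel) hK0 ?_ hr hrK _ hh
    intro c' h' hh'
    have hle : a22Ratio w1 w2 (WithLp.toLp 2 c') h' ≤ a22Const n w1 w2 :=
      le_iSup_of_le _ (le_iSup_of_le _ (le_iSup_of_le hh' le_rfl))
    rwa [a22Ratio, eAvg, eAvg, eAvg, setLIntegral_cube_div _ _ hh'.le,
      setLIntegral_cube_div _ _ hh'.le, setLIntegral_cube_div _ _ hh'.le, ← hofK] at hle
  refine ⟨lt_of_le_of_lt hmain ?_, hmain⟩
  exact ENNReal.mul_lt_top ENNReal.ofReal_lt_top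
    (ENNReal.rpow_lt_top_of_nonneg (by linarith) hfin.ne)
end
end

section
/- Let n ≥ 1 and 1 < p < ∞. There exist constants 0 < c ≤ C depending only on n and p such that for every a with −n < a < n(p−1), the power weight ω(x) = |x|^a on ℝ^n belongs to A_p and c ≤ [|x|^a]_{A_p} · (n+a)(n(p−1)−a)^{p−1} ≤ C. In particular, [|x|^a]_{A₃} ∼ 1/((n+a)(2n−a)²) for a ∈ (−n, 2n) and [|x|^a]_{A₄} ∼ 1/((n+a)(3n−a)³) for a ∈ (−n, 3n). -/
open MeasureTheory ENNReal Filter Set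
open scoped ENNReal NNReal

noncomputable section

lemma volume_cube {n : ℕ} (c : Euc n) {h : ℝ} (hh : 0 < h) :
    volume (cube c h) = ENNReal.ofReal ((2 * h) ^ n) := by
  have hpre : cube c h = (@WithLp.ofLp 2 (Fin n → ℝ)) ⁻¹'
      Icc (fun i => c i - h) (fun i => c i + h) := by
    ext x
    simp only [cube, mem_ofPred_eq, mem_preimage, mem_Icc, Pi.le_def, abs_le, ← forall_and]
    refine forall_congr' fun i => ?_
    constructor <;> rintro ⟨h₁, h₂⟩ <;> constructor <;> linarith
  rw [hpre, (PiLp.volume_preserving_ofLp (Fin n)).measure_preimage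
    measurableSet_Icc.nullMeasurableSet, Real.volume_Icc_pi]
  have hside (i : Fin n) : c i + h - (c i - h) = 2 * h := by ring
  simp [hside, ENNReal.ofReal_pow (by positivity : (0:ℝ) ≤ 2 * h)]

lemma ball_subset_cube {n : ℕ} (c : Euc n) (h : ℝ) : Metric.ball c h ⊆ cube c h := by
  intro x hx i
  rw [mem_ball_iff_norm] at hx
  simpa using (PiLp.norm_apply_le (x - c) i).trans hx.le

lemma norm_sub_le_of_mem_cube {n : ℕ} {c x : Euc n} {h : ℝ} (hh : 0 < h) (hx : x ∈ cube c h) :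
    ‖x - c‖ ≤ √n * h := by
  rw [EuclideanSpace.norm_eq, Real.sqrt_le_left (by positivity), mul_pow,
    Real.sq_sqrt (by positivity)]
  calc ∑ i, ‖(x - c) i‖ ^ 2 ≤ ∑ _i : Fin n, h ^ 2 :=
        Finset.sum_le_sum fun i _ => pow_le_pow_left₀ (norm_nonneg _) (by simpa using hx i) 2
    _ = n * h ^ 2 := by simp

/-- The integral of a power of the norm over a ball centred at the origin. -/
lemma lintegral_norm_rpow_ball {n : ℕ} (hn : 1 ≤ n) {s r : ℝ} (hs : -(n : ℝ) < s) (hr : 0 < r) :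
    ∫⁻ x in Metric.ball (0 : Euc n) r, ENNReal.ofReal (‖x‖ ^ s) =
      ENNReal.ofReal (n * volume.real (Metric.ball (0 : Euc n) 1) * (r ^ (n + s) / (n + s))) := by
  have : Nontrivial (Euc n) := by
    have : Nonempty (Fin n) := ⟨⟨0, hn⟩⟩
    infer_instance
  have hpow : ∀ y ∈ Ioo (0 : ℝ) r, y ^ (n - 1) • y ^ s = y ^ ((n : ℝ) - 1 + s) := by
    intro y hy
    rw [Real.rpow_add hy.1, ← Nat.cast_pred hn, Real.rpow_natCast, smul_eq_mul]
  have hint : IntegrableOn (fun x : Euc n => ‖x‖ ^ s) (Metric.ball 0 r) := by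
    rw [integrableOn_fun_norm_addHaar volume (f := fun y : ℝ => y ^ s), finrank_euclideanSpace_fin,
      integrableOn_congr_fun hpow measurableSet_Ioo,
      intervalIntegral.integrableOn_Ioo_rpow_iff hr]
    linarith
  rw [← ofReal_integral_eq_lintegral_ofReal hint
    (ae_of_all _ fun x => Real.rpow_nonneg (norm_nonneg x) s)]
  congr 1
  have hind : ∀ x : Euc n, (Metric.ball (0 : Euc n) r).indicator (fun x => ‖x‖ ^ s) x =
      (Iio r).indicator (fun y : ℝ => y ^ s) ‖x‖ := by
    intro x; simp [indicator]
  rw [← integral_indicator Metric.isOpen_ball.measurableSet, integral_congr_ae (ae_of_all _ hind),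
    integral_fun_norm_addHaar, finrank_euclideanSpace_fin, nsmul_eq_mul, smul_eq_mul, ← mul_assoc]
  congr 1
  have hmul : ∀ y : ℝ, y ^ (n - 1) • (Iio r).indicator (fun y : ℝ => y ^ s) y =
      (Iio r).indicator (fun y : ℝ => y ^ (n - 1) • y ^ s) y := by
    intro y; by_cases hy : y < r <;> simp [indicator, hy]
  simp_rw [hmul]
  rw [setIntegral_indicator measurableSet_Iio, Ioi_inter_Iio,
    setIntegral_congr_fun measurableSet_Ioo hpow, ← integral_Ioc_eq_integral_Ioo,
    ← intervalIntegral.integral_of_le hr.le, integral_rpow (Or.inl (by linarith))]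
  have hexp : (n : ℝ) - 1 + s + 1 = n + s := by ring
  rw [hexp, Real.zero_rpow (by linarith), sub_zero]

lemma eAvg_le_of_le {n : ℕ} {w : Euc n → ℝ} {c : Euc n} {h M : ℝ}
    (hw : ∀ x ∈ cube c h, w x ≤ M) : eAvg w c h ≤ ENNReal.ofReal M := by
  refine ENNReal.div_le_of_le_mul ?_
  calc ∫⁻ x in cube c h, ENNReal.ofReal (w x) ≤ ∫⁻ _x in cube c h, ENNReal.ofReal M :=
        setLIntegral_mono measurable_const fun x hx => ENNReal.ofReal_le_ofReal (hw x hx)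
    _ = ENNReal.ofReal M * volume (cube c h) := setLIntegral_const _ _

lemma eAvg_norm_rpow_le {n : ℕ} (hn : 1 ≤ n) {s r h : ℝ} {c : Euc n} (hs : -(n : ℝ) < s)
    (hr : 0 < r) (hh : 0 < h) (hsub : cube c h ⊆ Metric.ball 0 r) :
    eAvg (fun x => ‖x‖ ^ s) c h ≤ ENNReal.ofReal
      (n * volume.real (Metric.ball (0 : Euc n) 1) * (r ^ (n + s) / (n + s)) / (2 * h) ^ n) := by
  rw [eAvg, volume_cube c hh, ENNReal.ofReal_div_of_pos (by positivity),
    ← lintegral_norm_rpow_ball hn hs hr]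
  gcongr

lemma le_eAvg_norm_rpow {n : ℕ} (hn : 1 ≤ n) {s : ℝ} (hs : -(n : ℝ) < s) :
    ENNReal.ofReal (n * volume.real (Metric.ball (0 : Euc n) 1) / 2 ^ n / (n + s)) ≤
      eAvg (fun x => ‖x‖ ^ s) (0 : Euc n) 1 := by
  have h₁ := lintegral_norm_rpow_ball hn hs one_pos
  rw [Real.one_rpow, mul_one_div] at h₁
  rw [eAvg, volume_cube 0 one_pos, mul_one, div_right_comm, ENNReal.ofReal_div_of_pos (by positivity),
    ← h₁]
  gcongr
  exact ball_subset_cube 0 1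

/-- On a set where the norm is comparable to a fixed `t`, so are the powers of the norm. -/
lemma rpow_le_two_rpow_abs_mul {t y s : ℝ} (ht : 0 < t) (hy₁ : t / 2 ≤ y) (hy₂ : y ≤ 2 * t) :
    y ^ s ≤ 2 ^ |s| * t ^ s := by
  rcases le_total 0 s with hs | hs
  · rw [abs_of_nonneg hs, ← Real.mul_rpow (by norm_num) ht.le]
    exact Real.rpow_le_rpow (by linarith) hy₂ hs
  · have h2 : (2 : ℝ) ^ |s| = (1 / 2) ^ s := by
      rw [abs_of_nonpos hs, Real.rpow_neg (by norm_num), one_div, Real.inv_rpow (by norm_num)]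
    rw [h2, ← Real.mul_rpow (by norm_num) ht.le]
    exact Real.rpow_le_rpow_of_nonpos (by linarith) (by linarith) hs

lemma apRatio_norm_rpow {n : ℕ} {p : ℝ} (hp : 1 < p) (a : ℝ) (c : Euc n) (h : ℝ) :
    apRatio p (fun x => ‖x‖ ^ a) c h =
      eAvg (fun x => ‖x‖ ^ a) c h * eAvg (fun x => ‖x‖ ^ (-a / (p - 1))) c h ^ (p - 1) := by
  have hexp : a * (1 - conjExp p) = -a / (p - 1) := by
    have : p - 1 ≠ 0 := by linarith
    rw [conjExp]; field_simp; ring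
  simp only [apRatio, ← Real.rpow_mul (norm_nonneg _), hexp]

lemma ofReal_mul_ofReal_rpow {A B q : ℝ} (hA : 0 ≤ A) (hB : 0 ≤ B) (hq : 0 ≤ q) :
    ENNReal.ofReal A * ENNReal.ofReal B ^ q = ENNReal.ofReal (A * B ^ q) := by
  rw [ENNReal.ofReal_rpow_of_nonneg hB hq, ENNReal.ofReal_mul hA]

/-- The `A_p` ratio of a power weight on a cube close to the origin relative to its size. -/
lemma apRatio_norm_rpow_le_of_near {n : ℕ} (hn : 1 ≤ n) {p a h : ℝ} (hp : 1 < p)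
    (ha : -(n : ℝ) < a) (ha' : a < n * (p - 1)) (c : Euc n) (hh : 0 < h)
    (hc : ‖c‖ ≤ 2 * (√n * h)) :
    apRatio p (fun x => ‖x‖ ^ a) c h ≤ ENNReal.ofReal
      ((n * volume.real (Metric.ball (0 : Euc n) 1) * (2 * √n) ^ n) ^ p * (p - 1) ^ (p - 1) /
        ((n + a) * (n * (p - 1) - a) ^ (p - 1))) := by
  have hq : 0 < p - 1 := by linarith
  have hn0 : (0 : ℝ) < n := by exact_mod_cast hn
  set b := -a / (p - 1) with hb_def
  have hab : n + b = (n * (p - 1) - a) / (p - 1) := by rw [hb_def]; field_simp; ring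
  have hd : 0 < (n : ℝ) * (p - 1) - a := by linarith
  have hnb : 0 < n + b := by rw [hab]; positivity
  have hna : 0 < n + a := by linarith
  set v := volume.real (Metric.ball (0 : Euc n) 1)
  have hv : 0 ≤ v := measureReal_nonneg
  set r := 4 * (√n * h) with hr_def
  have hr : 0 < r := by positivity
  have hsub : cube c h ⊆ Metric.ball 0 r := by
    intro x hx
    rw [mem_ball_zero_iff]
    have h₁ := norm_sub_le_of_mem_cube hh hx
    have h₂ := norm_sub_norm_le x c
    have : 0 < √n * h := by positivity
    linarith
  have hsimp (s : ℝ) : n * v * (r ^ (n + s) / (n + s)) / (2 * h) ^ n =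
      n * v * (2 * √n) ^ n / (n + s) * r ^ s := by
    have hrh : r = (2 * √n) * (2 * h) := by rw [hr_def]; ring
    have : r ^ n / (2 * h) ^ n = (2 * √n) ^ n := by
      rw [hrh, mul_pow]; field_simp
    rw [← this, Real.rpow_add hr, Real.rpow_natCast]
    ring
  have hA := eAvg_norm_rpow_le hn ha hr hh hsub
  have hB := eAvg_norm_rpow_le hn (by linarith : -(n : ℝ) < b) hr hh hsub
  rw [hsimp] at hA hB
  set K := n * v * (2 * √n) ^ n
  have hK : 0 ≤ K := by positivity
  rw [apRatio_norm_rpow hp]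
  refine (mul_le_mul' hA (ENNReal.rpow_le_rpow hB hq.le)).trans ?_
  rw [ofReal_mul_ofReal_rpow (by positivity) (by positivity) hq.le]
  refine ENNReal.ofReal_le_ofReal (le_of_eq ?_)
  have hba : b * (p - 1) = -a := by rw [hb_def]; field_simp
  have hKp : K ^ p = K * K ^ (p - 1) := by
    conv_lhs => rw [show p = 1 + (p - 1) by ring]
    rw [Real.rpow_add' hK (by linarith), Real.rpow_one]
  rw [Real.mul_rpow (by positivity : 0 ≤ K / (n + b)) (Real.rpow_nonneg hr.le b),
    ← Real.rpow_mul hr.le, hba, Real.rpow_neg hr.le,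
    Real.div_rpow hK hnb.le, hab, Real.div_rpow hd.le hq.le, hKp]
  have := Real.rpow_pos_of_pos hr a
  field_simp

/-- The `A_p` ratio of a power weight on a cube far from the origin relative to its size. -/
lemma apRatio_norm_rpow_le_of_far {n : ℕ} {p a h : ℝ} (hp : 1 < p)
    (ha : -(n : ℝ) < a) (ha' : a < n * (p - 1)) (c : Euc n) (hh : 0 < h)
    (hc : 2 * (√n * h) < ‖c‖) :
    apRatio p (fun x => ‖x‖ ^ a) c h ≤ ENNReal.ofReal (4 ^ (n * p)) := by
  have hq : 0 < p - 1 := by linarith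
  have hR : 0 ≤ √n * h := by positivity
  have ht : 0 < ‖c‖ := by linarith
  have hbound (s : ℝ) : ∀ x ∈ cube c h, ‖x‖ ^ s ≤ 2 ^ |s| * ‖c‖ ^ s := by
    intro x hx
    have h₁ := norm_sub_le_of_mem_cube hh hx
    have h₂ := norm_sub_norm_le x c
    have h₃ := norm_sub_norm_le c x
    rw [norm_sub_rev] at h₃
    exact rpow_le_two_rpow_abs_mul ht (by linarith) (by linarith)
  rw [apRatio_norm_rpow hp]
  refine (mul_le_mul' (eAvg_le_of_le (hbound a))
    (ENNReal.rpow_le_rpow (eAvg_le_of_le (hbound _)) hq.le)).trans ?_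
  rw [ofReal_mul_ofReal_rpow (by positivity) (by positivity) hq.le]
  refine ENNReal.ofReal_le_ofReal ?_
  have hba : -a / (p - 1) * (p - 1) = -a := by field_simp
  have hba' : |-a / (p - 1)| * (p - 1) = |a| := by
    rw [abs_div, abs_neg, abs_of_pos hq]; field_simp
  rw [Real.mul_rpow (by positivity) (by positivity), ← Real.rpow_mul (by norm_num),
    ← Real.rpow_mul ht.le, hba, hba', Real.rpow_neg ht.le]
  have hca := Real.rpow_pos_of_pos ht a
  calc (2 : ℝ) ^ |a| * ‖c‖ ^ a * (2 ^ |a| * (‖c‖ ^ a)⁻¹) = 2 ^ |a| * 2 ^ |a| := by field_simp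
    _ = 4 ^ |a| := by rw [← Real.mul_rpow (by norm_num) (by norm_num)]; norm_num
    _ ≤ 4 ^ (n * p) := by
      refine Real.rpow_le_rpow_of_exponent_le (by norm_num) (abs_le.2 ⟨?_, ?_⟩) <;>
        nlinarith [(Nat.cast_nonneg n : (0 : ℝ) ≤ n)]

lemma le_apConst_norm_rpow {n : ℕ} (hn : 1 ≤ n) {p a : ℝ} (hp : 1 < p)
    (ha : -(n : ℝ) < a) (ha' : a < n * (p - 1)) :
    ENNReal.ofReal
      ((n * volume.real (Metric.ball (0 : Euc n) 1) / 2 ^ n) ^ p * (p - 1) ^ (p - 1) /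
        ((n + a) * (n * (p - 1) - a) ^ (p - 1))) ≤ apConst n p (fun x => ‖x‖ ^ a) := by
  have hq : 0 < p - 1 := by linarith
  set b := -a / (p - 1) with hb_def
  have hab : n + b = (n * (p - 1) - a) / (p - 1) := by rw [hb_def]; field_simp; ring
  have hd : 0 < (n : ℝ) * (p - 1) - a := by linarith
  have hnb : 0 < n + b := by rw [hab]; positivity
  have hna : 0 < n + a := by linarith
  have hA := le_eAvg_norm_rpow hn ha
  have hB := le_eAvg_norm_rpow hn (by linarith : -(n : ℝ) < b)
  have hv : 0 ≤ volume.real (Metric.ball (0 : Euc n) 1) := measureReal_nonneg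
  set K := n * volume.real (Metric.ball (0 : Euc n) 1) / 2 ^ n
  have hK : 0 ≤ K := by positivity
  have hKp : K ^ p = K * K ^ (p - 1) := by
    conv_lhs => rw [show p = 1 + (p - 1) by ring]
    rw [Real.rpow_add' hK (by linarith), Real.rpow_one]
  have hle : apRatio p (fun x => ‖x‖ ^ a) (0 : Euc n) 1 ≤ apConst n p (fun x => ‖x‖ ^ a) :=
    le_iSup_of_le 0 (le_iSup_of_le 1 (le_iSup_of_le one_pos le_rfl))
  refine le_trans ?_ hle
  rw [apRatio_norm_rpow hp]
  refine le_trans ?_ (mul_le_mul' hA (ENNReal.rpow_le_rpow hB hq.le))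
  rw [ofReal_mul_ofReal_rpow (by positivity) (by positivity) hq.le]
  refine ENNReal.ofReal_le_ofReal (le_of_eq ?_)
  rw [Real.div_rpow hK hnb.le, hab, Real.div_rpow hd.le hq.le, hKp]
  field_simp

/-- Sharp asymptotics of the `A_p` constant of power weights.
For `1 < p < ∞` there are `0 < c ≤ C` depending only on `n` and `p` such that for
`-n < a < n(p-1)`, the weight `|x|^a` is in `A_p` and
`[|x|^a]_{A_p} ∼ ((n+a)·(n(p-1)-a)^{p-1})⁻¹`. -/
theorem power_weight_Ap_constant (n : ℕ) (hn : 1 ≤ n) (p : ℝ) (hp : 1 < p) :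
    ∃ c C : ℝ, 0 < c ∧ c ≤ C ∧
      ∀ a : ℝ, -(n:ℝ) < a → a < n * (p - 1) →
        apConst n p (fun x => ‖x‖ ^ a) < ⊤ ∧
        c ≤ (apConst n p (fun x => ‖x‖ ^ a)).toReal * (((n:ℝ) + a) * ((n:ℝ) * (p-1) - a) ^ (p-1)) ∧
        (apConst n p (fun x => ‖x‖ ^ a)).toReal * (((n:ℝ) + a) * ((n:ℝ) * (p-1) - a) ^ (p-1)) ≤ C := by
  have hq : 0 < p - 1 := by linarith
  have hn0 : (0 : ℝ) < n := by exact_mod_cast hn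
  have hv : 0 < volume.real (Metric.ball (0 : Euc n) 1) :=
    ENNReal.toReal_pos (Metric.measure_ball_pos _ _ one_pos).ne' measure_ball_lt_top.ne
  set c := (n * volume.real (Metric.ball (0 : Euc n) 1) / 2 ^ n) ^ p * (p - 1) ^ (p - 1) with hc_def
  set C₁ := (n * volume.real (Metric.ball (0 : Euc n) 1) * (2 * √n) ^ n) ^ p * (p - 1) ^ (p - 1)
  set C₂ : ℝ := 4 ^ (n * p) * (n * p) ^ p
  have hc : 0 < c := by positivity
  refine ⟨c, max c (max C₁ C₂), hc, le_max_left _ _, fun a ha ha' => ?_⟩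
  have hna : 0 < n + a := by linarith
  have hd : 0 < (n : ℝ) * (p - 1) - a := by linarith
  set D := ((n : ℝ) + a) * (n * (p - 1) - a) ^ (p - 1) with hD_def
  have hD : 0 < D := by positivity
  have hDle : D ≤ (n * p) ^ p := by
    have hpp : ((n : ℝ) * p) ^ p = n * p * (n * p) ^ (p - 1) := by
      rw [Real.rpow_sub_one (by positivity)]
      field_simp
    rw [hpp, hD_def]
    gcongr <;> nlinarith
  have hupper : apConst n p (fun x => ‖x‖ ^ a) ≤ ENNReal.ofReal (max c (max C₁ C₂) / D) := by
    refine iSup_le fun x => iSup_le fun h => iSup_le fun hh => ?_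
    rcases le_or_gt ‖x‖ (2 * (√n * h)) with hx | hx
    · refine (apRatio_norm_rpow_le_of_near hn hp ha ha' x hh hx).trans
        (ENNReal.ofReal_le_ofReal ?_)
      gcongr
      exact (le_max_left _ _).trans (le_max_right _ _)
    · refine (apRatio_norm_rpow_le_of_far hp ha ha' x hh hx).trans (ENNReal.ofReal_le_ofReal ?_)
      rw [le_div_iff₀ hD]
      refine le_trans ?_ ((le_max_right C₁ C₂).trans (le_max_right _ _))
      exact mul_le_mul_of_nonneg_left hDle (by positivity)
  have hlower := le_apConst_norm_rpow hn hp ha ha'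
  have hfin := hupper.trans_lt ENNReal.ofReal_lt_top
  refine ⟨hfin, ?_, ?_⟩
  · rw [← div_le_iff₀ hD]
    exact (ENNReal.ofReal_le_iff_le_toReal hfin.ne).1 hlower
  · rw [← le_div_iff₀ hD]
    exact ENNReal.toReal_le_of_le_ofReal
      (div_nonneg (hc.le.trans (le_max_left _ _)) hD.le) hupper
end
end
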